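/- arXiv:1812.09320 — 2 statements merged into one kernel-verified Lean document; each statement's English description precedes it below -/
import Mathlib

section
/- For all real numbers 0 < λ < μ with 2λ ≠ μ and all α > 0, letting ρ = λ/μ and writing Ei(−x) = −E1(x) for x > 0, the average logarithmic CoUD C_L of the M/M/1 FCFS queue (given by Theorem 3) is upper bounded by λ · e^{(μ−λ)/α}·( λ·Ei((λ−μ)/α) + (λ−μ)·Ei(−λ/α)·e^{(2λ−μ)/α} ) / ( λ(μ−2λ) ); that is, ∫_0^∞ log(αt+1)·C(t) dt ≤ λ·e^{(μ−λ)/α}·( −λ·E1((μ−λ)/α) + (μ−λ)·E1(λ/α)·e^{(2λ−μ)/α} ) / ( λ(μ−2λ) ). -/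
open MeasureTheory Real

/-- The exponential integral `E1 x = ∫_x^∞ e^{−t}/t dt`; the paper's `Ei` satisfies
`Ei (−x) = −E1 x` for `x > 0`. -/
noncomputable def E1 (x : ℝ) : ℝ := ∫ t in Set.Ioi x, Real.exp (-t) / t

open Filter Set Topology

/-- Translation of an integral over a half-line. -/
theorem integral_Ioi_zero_comp_add_right (g : ℝ → ℝ) (c : ℝ) :
    ∫ t in Ioi (0 : ℝ), g (t + c) = ∫ t in Ioi c, g t := by
  have h := (measurePreserving_add_right (volume : Measure ℝ) c).setIntegral_preimage_emb
    (measurableEmbedding_addRight c) g (Ioi c)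
  simpa using h

/-- The Laplace transform of `a / (a t + 1)` in terms of the exponential integral. -/
theorem integral_div_mul_exp_neg_eq_exp_mul_E1 {a r : ℝ} (ha : 0 < a) (hr : 0 < r) :
    ∫ t in Ioi (0 : ℝ), a / (a * t + 1) * exp (-r * t) = exp (r / a) * E1 (r / a) := by
  have hscale := integral_comp_mul_left_Ioi' (fun s => exp (-s) / s) (1 / a) hr
  rw [mul_one_div] at hscale
  rw [E1, ← hscale, ← integral_Ioi_zero_comp_add_right _ (1 / a), smul_eq_mul,
    ← integral_const_mul, ← integral_const_mul]
  refine setIntegral_congr_fun measurableSet_Ioi ?_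
  intro t (ht : 0 < t)
  have h₁ : a * t + 1 ≠ 0 := by positivity
  have h₂ : exp (-r * t) = exp (r / a) * exp (-(r * (t + 1 / a))) := by
    rw [← exp_add]
    congr 1
    field_simp
    ring
  dsimp only
  rw [h₂]
  field_simp

theorem integrableOn_pow_mul_exp_neg_mul (n : ℕ) {r : ℝ} (hr : 0 < r) :
    IntegrableOn (fun t : ℝ => t ^ n * exp (-r * t)) (Ioi 0) := by
  have hn : (-1 : ℝ) < n := by linarith [n.cast_nonneg (α := ℝ)]
  simpa using integrableOn_rpow_mul_exp_neg_mul_rpow hn one_pos hr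

theorem tendsto_pow_mul_exp_neg_mul_atTop (n : ℕ) {r : ℝ} (hr : 0 < r) :
    Tendsto (fun t : ℝ => t ^ n * exp (-r * t)) atTop (𝓝 0) := by
  simpa using tendsto_rpow_mul_exp_neg_mul_atTop_nhds_zero n r hr

theorem log_mul_add_one_nonneg {a t : ℝ} (ha : 0 < a) (ht : 0 ≤ t) : 0 ≤ log (a * t + 1) :=
  log_nonneg (by nlinarith [mul_nonneg ha.le ht])

theorem log_mul_add_one_le {a t : ℝ} (ha : 0 < a) (ht : 0 ≤ t) : log (a * t + 1) ≤ a * t := by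
  have h : 0 < a * t + 1 := by positivity
  linarith [log_le_sub_one_of_pos h]

theorem integrableOn_log_mul_pow_mul_exp_neg_mul (n : ℕ) {a r : ℝ} (ha : 0 < a) (hr : 0 < r) :
    IntegrableOn (fun t : ℝ => log (a * t + 1) * (t ^ n * exp (-r * t))) (Ioi 0) := by
  refine ((integrableOn_pow_mul_exp_neg_mul (n + 1) hr).const_mul a).mono'
    (Measurable.aestronglyMeasurable (by fun_prop)) ?_
  filter_upwards [self_mem_ae_restrict measurableSet_Ioi] with t (ht : 0 < t)
  have hpos : 0 ≤ t ^ n * exp (-r * t) := by positivity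
  rw [norm_of_nonneg (mul_nonneg (log_mul_add_one_nonneg ha ht.le) hpos)]
  calc log (a * t + 1) * (t ^ n * exp (-r * t)) ≤ a * t * (t ^ n * exp (-r * t)) :=
        mul_le_mul_of_nonneg_right (log_mul_add_one_le ha ht.le) hpos
    _ = a * (t ^ (n + 1) * exp (-r * t)) := by ring

theorem tendsto_log_mul_pow_mul_exp_neg_mul_atTop (n : ℕ) {a r : ℝ} (ha : 0 < a) (hr : 0 < r) :
    Tendsto (fun t : ℝ => log (a * t + 1) * (t ^ n * exp (-r * t))) atTop (𝓝 0) := by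
  have h := (tendsto_pow_mul_exp_neg_mul_atTop (n + 1) hr).const_mul a
  rw [mul_zero] at h
  refine squeeze_zero' ?_ ?_ h
  · filter_upwards [eventually_ge_atTop 0] with t ht
    exact mul_nonneg (log_mul_add_one_nonneg ha ht) (by positivity)
  · filter_upwards [eventually_ge_atTop 0] with t ht
    calc log (a * t + 1) * (t ^ n * exp (-r * t)) ≤ a * t * (t ^ n * exp (-r * t)) :=
          mul_le_mul_of_nonneg_right (log_mul_add_one_le ha ht) (by positivity)
      _ = a * (t ^ (n + 1) * exp (-r * t)) := by ring

theorem integrableOn_div_mul_pow_mul_exp_neg_mul (n : ℕ) {a r : ℝ} (ha : 0 < a) (hr : 0 < r) :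
    IntegrableOn (fun t : ℝ => a / (a * t + 1) * (t ^ n * exp (-r * t))) (Ioi 0) := by
  refine ((integrableOn_pow_mul_exp_neg_mul n hr).const_mul a).mono'
    (Measurable.aestronglyMeasurable (by fun_prop)) ?_
  filter_upwards [self_mem_ae_restrict measurableSet_Ioi] with t (ht : 0 < t)
  have hat : 0 < a * t := mul_pos ha ht
  rw [norm_of_nonneg (by positivity)]
  exact mul_le_mul_of_nonneg_right (div_le_self ha.le (by linarith)) (by positivity)

/-- The survival function of the stationary age of the M/M/1 FCFS queue. -/
noncomputable def ageTail (lam mu t : ℝ) : ℝ :=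
  mu / (mu - lam) * exp (-lam * t) + exp (-(mu - lam) * t)
    - (mu / (mu - lam) + lam * t) * exp (-mu * t)

/-- The stationary density of the age of the M/M/1 FCFS queue. -/
noncomputable def ageDensity (lam mu t : ℝ) : ℝ :=
  (lam ^ 2 / (lam - mu) - mu) * exp (-mu * t) + (lam * mu / (mu - lam)) * exp (-lam * t)
    - lam * mu * t * exp (-mu * t) + (mu - lam) * exp (-(mu - lam) * t)

/-- The survival function of a sum of independent exponentials of rates `lam` and `mu - lam`. -/
noncomputable def hypoexpTail (lam mu t : ℝ) : ℝ :=
  ((mu - lam) * exp (-lam * t) - lam * exp (-(mu - lam) * t)) / (mu - 2 * lam)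

theorem hasDerivAt_exp_neg_mul (r t : ℝ) :
    HasDerivAt (fun t => exp (-r * t)) (-r * exp (-r * t)) t := by
  simpa [mul_comm] using ((hasDerivAt_id t).const_mul (-r)).exp

theorem hasDerivAt_ageTail {lam mu : ℝ} (h : lam < mu) (t : ℝ) :
    HasDerivAt (ageTail lam mu) (-ageDensity lam mu t) t := by
  have hd := (((hasDerivAt_exp_neg_mul lam t).const_mul (mu / (mu - lam))).add
    (hasDerivAt_exp_neg_mul (mu - lam) t)).sub
    ((((hasDerivAt_id t).const_mul lam).const_add (mu / (mu - lam))).mul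
      (hasDerivAt_exp_neg_mul mu t))
  refine hd.congr_deriv ?_
  have h₁ : mu - lam ≠ 0 := by linarith
  have h₂ : lam - mu ≠ 0 := by linarith
  have h₃ : lam ^ 2 / (lam - mu) = -(lam ^ 2 / (mu - lam)) := by
    rw [← neg_sub mu lam, div_neg]
  simp only [ageDensity, id, h₃]
  field_simp
  ring

theorem integrableOn_log_mul_ageDensity {lam mu a : ℝ} (hlam : 0 < lam) (hlm : lam < mu)
    (ha : 0 < a) :
    IntegrableOn (fun t => log (a * t + 1) * ageDensity lam mu t) (Ioi 0) := by
  have hmu : 0 < mu := hlam.trans hlm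
  have h₁ := (integrableOn_log_mul_pow_mul_exp_neg_mul 0 ha hmu).const_mul
    (lam ^ 2 / (lam - mu) - mu)
  have h₂ := (integrableOn_log_mul_pow_mul_exp_neg_mul 0 ha hlam).const_mul
    (lam * mu / (mu - lam))
  have h₃ := (integrableOn_log_mul_pow_mul_exp_neg_mul 1 ha hmu).const_mul (lam * mu)
  have h₄ := (integrableOn_log_mul_pow_mul_exp_neg_mul 0 ha (sub_pos.2 hlm)).const_mul (mu - lam)
  refine (((h₁.add h₂).sub h₃).add h₄).congr (ae_of_all _ fun t => ?_)
  simp only [ageDensity, Pi.add_apply, Pi.sub_apply]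
  ring

theorem integrableOn_div_mul_ageTail {lam mu a : ℝ} (hlam : 0 < lam) (hlm : lam < mu)
    (ha : 0 < a) :
    IntegrableOn (fun t => a / (a * t + 1) * ageTail lam mu t) (Ioi 0) := by
  have hmu : 0 < mu := hlam.trans hlm
  have h₁ := (integrableOn_div_mul_pow_mul_exp_neg_mul 0 ha hlam).const_mul (mu / (mu - lam))
  have h₂ := integrableOn_div_mul_pow_mul_exp_neg_mul 0 ha (sub_pos.2 hlm)
  have h₃ := (integrableOn_div_mul_pow_mul_exp_neg_mul 0 ha hmu).const_mul (mu / (mu - lam))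
  have h₄ := (integrableOn_div_mul_pow_mul_exp_neg_mul 1 ha hmu).const_mul lam
  refine (((h₁.add h₂).sub h₃).sub h₄).congr (ae_of_all _ fun t => ?_)
  simp only [ageTail, Pi.add_apply, Pi.sub_apply]
  ring

theorem tendsto_log_mul_ageTail_atTop {lam mu a : ℝ} (hlam : 0 < lam) (hlm : lam < mu)
    (ha : 0 < a) :
    Tendsto (fun t => log (a * t + 1) * ageTail lam mu t) atTop (𝓝 0) := by
  have hmu : 0 < mu := hlam.trans hlm
  have h₁ := (tendsto_log_mul_pow_mul_exp_neg_mul_atTop 0 ha hlam).const_mul (mu / (mu - lam))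
  have h₂ := tendsto_log_mul_pow_mul_exp_neg_mul_atTop 0 ha (sub_pos.2 hlm)
  have h₃ := (tendsto_log_mul_pow_mul_exp_neg_mul_atTop 0 ha hmu).const_mul (mu / (mu - lam))
  have h₄ := (tendsto_log_mul_pow_mul_exp_neg_mul_atTop 1 ha hmu).const_mul lam
  have h := ((h₁.add h₂).sub h₃).sub h₄
  simp only [mul_zero, add_zero, sub_zero] at h
  refine h.congr fun t => ?_
  simp only [ageTail]
  ring

/-- The mean logarithmic age, integrated by parts. -/
theorem integral_log_mul_ageDensity {lam mu a : ℝ} (hlam : 0 < lam) (hlm : lam < mu)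
    (ha : 0 < a) :
    ∫ t in Ioi (0 : ℝ), log (a * t + 1) * ageDensity lam mu t
      = ∫ t in Ioi (0 : ℝ), a / (a * t + 1) * ageTail lam mu t := by
  have hu : ∀ t : ℝ, 0 ≤ t → HasDerivAt (fun t => log (a * t + 1)) (a / (a * t + 1)) t := by
    intro t ht
    have hne : a * t + 1 ≠ 0 := by positivity
    simpa using (((hasDerivAt_id t).const_mul a).add_const 1).log hne
  have hzero : Tendsto ((fun t => log (a * t + 1)) * ageTail lam mu) (𝓝[>] 0) (𝓝 0) := by
    have hc := (hu 0 le_rfl).continuousAt.mul (hasDerivAt_ageTail hlm 0).continuousAt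
    simpa [ContinuousAt] using hc.mono_left nhdsWithin_le_nhds
  have hparts := integral_Ioi_mul_deriv_eq_deriv_mul
    (u := fun t => log (a * t + 1)) (u' := fun t => a / (a * t + 1))
    (v := ageTail lam mu) (v' := fun t => -ageDensity lam mu t)
    (fun t (ht : 0 < t) => hu t ht.le) (fun t _ => hasDerivAt_ageTail hlm t)
    (by simpa [Pi.mul_def] using (integrableOn_log_mul_ageDensity hlam hlm ha).neg)
    (integrableOn_div_mul_ageTail hlam hlm ha) hzero
    (tendsto_log_mul_ageTail_atTop hlam hlm ha)
  simp only [mul_neg, integral_neg] at hparts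
  linarith

/-- The gap between the two survival functions, multiplied by `exp (mu * t)` with
`mu = lam + nu`, is nonnegative: it vanishes to first order at `0` and is convex. -/
theorem rescaled_tail_gap_nonneg {lam nu t : ℝ} (hlam : 0 < lam) (hnu : 0 < nu) (hne : lam ≠ nu)
    (ht : 0 ≤ t) :
    0 ≤ lam ^ 2 / (nu * (nu - lam)) * exp (nu * t) - nu / (nu - lam) * exp (lam * t)
      + (lam + nu) / nu + lam * t := by
  have hsub : nu - lam ≠ 0 := sub_ne_zero.2 hne.symm
  have hexp : ∀ r s : ℝ, HasDerivAt (fun s => exp (r * s)) (r * exp (r * s)) s := fun r s => by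
    simpa using hasDerivAt_exp_neg_mul (-r) s
  let K' : ℝ → ℝ := fun s =>
    lam ^ 2 / (nu - lam) * exp (nu * s) - nu * lam / (nu - lam) * exp (lam * s) + lam
  have hK' : ∀ s, HasDerivAt K' (lam ^ 2 * nu * ((exp (nu * s) - exp (lam * s)) / (nu - lam))) s :=
    fun s => ((((hexp nu s).const_mul (lam ^ 2 / (nu - lam))).sub
      ((hexp lam s).const_mul (nu * lam / (nu - lam)))).add_const lam).congr_deriv (by ring)
  have hK'_nonneg : ∀ s, 0 ≤ s → 0 ≤ K' s := by
    intro s hs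
    have hmono : MonotoneOn K' (Ici 0) := by
      refine monotoneOn_of_deriv_nonneg (convex_Ici 0)
        (fun s _ => (hK' s).continuousAt.continuousWithinAt)
        (fun s _ => (hK' s).differentiableAt.differentiableWithinAt) fun s hs => ?_
      rw [interior_Ici] at hs
      have hs : 0 < s := hs
      rw [(hK' s).deriv]
      refine mul_nonneg (by positivity) ?_
      rcases lt_or_gt_of_ne hne with h | h
      · exact div_nonneg (sub_nonneg.2 (exp_le_exp.2 (by gcongr))) (by linarith)
      · exact div_nonneg_of_nonpos (sub_nonpos.2 (exp_le_exp.2 (by gcongr))) (by linarith)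
    have hzero : K' 0 = 0 := by
      simp only [K', mul_zero, exp_zero]
      field_simp
      ring
    exact hzero ▸ hmono self_mem_Ici hs hs
  let K : ℝ → ℝ := fun s => lam ^ 2 / (nu * (nu - lam)) * exp (nu * s)
    - nu / (nu - lam) * exp (lam * s) + (lam + nu) / nu + lam * s
  have hK : ∀ s, HasDerivAt K (K' s) s := fun s =>
    (((((hexp nu s).const_mul (lam ^ 2 / (nu * (nu - lam)))).sub
      ((hexp lam s).const_mul (nu / (nu - lam)))).add_const ((lam + nu) / nu)).add
      ((hasDerivAt_id s).const_mul lam)).congr_deriv (by simp only [K']; field_simp)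
  have hmono : MonotoneOn K (Ici 0) := by
    refine monotoneOn_of_deriv_nonneg (convex_Ici 0)
      (fun s _ => (hK s).continuousAt.continuousWithinAt)
      (fun s _ => (hK s).differentiableAt.differentiableWithinAt) fun s hs => ?_
    rw [interior_Ici] at hs
    exact (hK s).deriv ▸ hK'_nonneg s (le_of_lt hs)
  have hzero : K 0 = 0 := by
    simp only [K, mul_zero, exp_zero]
    field_simp
    ring
  exact hzero ▸ hmono self_mem_Ici ht ht

/-- The stationary age is stochastically dominated by the hypoexponential distribution. -/
theorem ageTail_le_hypoexpTail {lam mu t : ℝ} (hlam : 0 < lam) (hlm : lam < mu)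
    (hne : 2 * lam ≠ mu) (ht : 0 ≤ t) : ageTail lam mu t ≤ hypoexpTail lam mu t := by
  obtain ⟨nu, rfl⟩ : ∃ nu, mu = lam + nu := ⟨mu - lam, by ring⟩
  have hnu : 0 < nu := by linarith
  have hne' : lam ≠ nu := fun h => hne (by linarith)
  have hsub : nu - lam ≠ 0 := sub_ne_zero.2 hne'.symm
  have hgap := mul_nonneg (exp_pos (-(lam + nu) * t)).le
    (rescaled_tail_gap_nonneg hlam hnu hne' ht)
  have e₁ : exp (-lam * t) = exp (-(lam + nu) * t) * exp (nu * t) := by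
    rw [← exp_add]; ring_nf
  have e₂ : exp (-nu * t) = exp (-(lam + nu) * t) * exp (lam * t) := by
    rw [← exp_add]; ring_nf
  refine sub_nonneg.1 (hgap.trans_eq ?_)
  simp only [ageTail, hypoexpTail, add_sub_cancel_left]
  rw [show lam + nu - 2 * lam = nu - lam by ring, e₁, e₂]
  field_simp
  ring

theorem integrableOn_div_mul_hypoexpTail {lam mu a : ℝ} (hlam : 0 < lam) (hlm : lam < mu)
    (ha : 0 < a) :
    IntegrableOn (fun t => a / (a * t + 1) * hypoexpTail lam mu t) (Ioi 0) := by
  have h₁ := (integrableOn_div_mul_pow_mul_exp_neg_mul 0 ha hlam).const_mul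
    ((mu - lam) / (mu - 2 * lam))
  have h₂ := (integrableOn_div_mul_pow_mul_exp_neg_mul 0 ha (sub_pos.2 hlm)).const_mul
    (lam / (mu - 2 * lam))
  refine (h₁.sub h₂).congr (ae_of_all _ fun t => ?_)
  simp only [hypoexpTail, Pi.sub_apply]
  ring

theorem integral_div_mul_hypoexpTail {lam mu a : ℝ} (hlam : 0 < lam) (hlm : lam < mu)
    (ha : 0 < a) :
    ∫ t in Ioi (0 : ℝ), a / (a * t + 1) * hypoexpTail lam mu t
      = (mu - lam) / (mu - 2 * lam) * (exp (lam / a) * E1 (lam / a))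
        - lam / (mu - 2 * lam) * (exp ((mu - lam) / a) * E1 ((mu - lam) / a)) := by
  have h₁ := integrableOn_div_mul_pow_mul_exp_neg_mul 0 ha hlam
  have h₂ := integrableOn_div_mul_pow_mul_exp_neg_mul 0 ha (sub_pos.2 hlm)
  simp only [pow_zero, one_mul] at h₁ h₂
  rw [← integral_div_mul_exp_neg_eq_exp_mul_E1 ha hlam,
    ← integral_div_mul_exp_neg_eq_exp_mul_E1 ha (sub_pos.2 hlm), ← integral_const_mul,
    ← integral_const_mul, ← integral_sub (h₁.const_mul _) (h₂.const_mul _)]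
  congr 1 with t
  simp only [hypoexpTail]
  ring

/-- Upper bound on the average logarithmic CoUD of the M/M/1 FCFS queue:
`C_L ≤ λ e^{(μ−λ)/α}( λ Ei((λ−μ)/α) + (λ−μ) Ei(−λ/α) e^{(2λ−μ)/α} ) / (λ(μ−2λ))`,
written with `Ei(−x) = −E1(x)`. -/
theorem logarithmic_CoUD_le_bound (lam mu alpha : ℝ) (hlam : 0 < lam) (hlm : lam < mu)
    (hne : 2 * lam ≠ mu) (halpha : 0 < alpha) :
    (∫ t in Set.Ioi (0:ℝ), Real.log (alpha * t + 1) *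
        ((lam ^ 2 / (lam - mu) - mu) * Real.exp (-mu * t)
          + (lam * mu / (mu - lam)) * Real.exp (-lam * t)
          - lam * mu * t * Real.exp (-mu * t)
          + (mu - lam) * Real.exp (-(mu - lam) * t)))
      ≤ lam * Real.exp ((mu - lam) / alpha) *
          (-(lam * E1 ((mu - lam) / alpha))
            + (mu - lam) * E1 (lam / alpha) * Real.exp ((2 * lam - mu) / alpha))
          / (lam * (mu - 2 * lam)) := by
  calc
    _ = ∫ t in Ioi (0 : ℝ), alpha / (alpha * t + 1) * ageTail lam mu t :=
      integral_log_mul_ageDensity hlam hlm halpha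
    _ ≤ ∫ t in Ioi (0 : ℝ), alpha / (alpha * t + 1) * hypoexpTail lam mu t := by
      refine setIntegral_mono_on (integrableOn_div_mul_ageTail hlam hlm halpha)
        (integrableOn_div_mul_hypoexpTail hlam hlm halpha) measurableSet_Ioi
        fun t (ht : 0 < t) => ?_
      exact mul_le_mul_of_nonneg_left (ageTail_le_hypoexpTail hlam hlm hne ht.le) (by positivity)
    _ = _ := by
      have hsub : mu - 2 * lam ≠ 0 := sub_ne_zero.2 hne.symm
      have hexp : exp (lam / alpha)
          = exp ((mu - lam) / alpha) * exp ((2 * lam - mu) / alpha) := by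
        rw [← exp_add]
        ring_nf
      rw [integral_div_mul_hypoexpTail hlam hlm halpha, hexp]
      field_simp
      ring
end

section
/- For all real numbers λ > 0, β > 0 with β ≠ λ, and α > 0, ∫_0^∞ e^{(β−λ)y}·E1(β y + β/α) dy = ( e^{(λ−β)/α}·E1(λ/α) − E1(β/α) ) / (β − λ); equivalently, in terms of the paper's Ei, ∫_0^∞ e^{(β−λ)y}·Ei(−β y − β/α) dy = −( Ei(−β/α) − e^{(λ−β)/α}·Ei(−λ/α) ) / (β − λ). -/
open MeasureTheory Real

lemma integrableOn_exp_neg_div_Ioi {x : ℝ} (hx : 0 < x) :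
    IntegrableOn (fun t : ℝ => Real.exp (-t) / t) (Set.Ioi x) := by
  refine ((integrableOn_exp_neg_Ioi x).div_const x).mono'
    (by fun_prop : Measurable fun t : ℝ => Real.exp (-t) / t).aestronglyMeasurable ?_
  filter_upwards [ae_restrict_mem measurableSet_Ioi] with t ht
  have ht : x < t := ht
  rw [Real.norm_of_nonneg (div_nonneg (Real.exp_pos _).le (hx.trans ht).le)]
  gcongr

lemma E1_nonneg {x : ℝ} (hx : 0 < x) : 0 ≤ E1 x :=
  setIntegral_nonneg measurableSet_Ioi fun _ ht =>
    div_nonneg (Real.exp_pos _).le (hx.trans ht).le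

lemma E1_le_exp_neg_div {x : ℝ} (hx : 0 < x) : E1 x ≤ Real.exp (-x) / x := by
  rw [← integral_exp_neg_Ioi x, ← integral_div]
  refine setIntegral_mono_on (integrableOn_exp_neg_div_Ioi hx)
    ((integrableOn_exp_neg_Ioi x).div_const x) measurableSet_Ioi fun t ht => ?_
  have ht : x < t := ht
  gcongr

lemma hasDerivAt_E1 {x : ℝ} (hx : 0 < x) : HasDerivAt E1 (-(Real.exp (-x) / x)) x := by
  have hc : 0 < x / 2 := half_pos hx
  have hint : IntervalIntegrable (fun t : ℝ => Real.exp (-t) / t) volume (x / 2) x :=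
    (intervalIntegrable_iff_integrableOn_Ioc_of_le (half_le_self hx.le)).2
      ((integrableOn_exp_neg_div_Ioi hc).mono_set Set.Ioc_subset_Ioi_self)
  have hderiv := (intervalIntegral.integral_hasDerivAt_right hint
    (by fun_prop : Measurable fun t : ℝ =>
      Real.exp (-t) / t).stronglyMeasurable.stronglyMeasurableAtFilter
    (by fun_prop (disch := exact hx.ne'))).const_sub (E1 (x / 2))
  refine hderiv.congr_of_eventuallyEq ?_
  filter_upwards [lt_mem_nhds hx] with y hy
  rw [eq_sub_iff_add_eq', E1, E1]
  exact intervalIntegral.integral_interval_add_Ioi (integrableOn_exp_neg_div_Ioi hc)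
    (integrableOn_exp_neg_div_Ioi hy)

/-- If `a ≤ b`, the exponential decay of `E1 (b * y + c)` absorbs the growth of `exp (a * y)`. -/
lemma tendsto_exp_mul_E1_atTop {a b c : ℝ} (hab : a ≤ b) (hb : 0 < b) (hc : 0 < c) :
    Filter.Tendsto (fun y : ℝ => Real.exp (a * y) * E1 (b * y + c)) Filter.atTop (nhds 0) := by
  have hlin : Filter.Tendsto (fun y : ℝ => b * y + c) Filter.atTop Filter.atTop :=
    Filter.tendsto_atTop_add_const_right _ _ (Filter.tendsto_id.const_mul_atTop hb)
  refine squeeze_zero' ?_ ?_ hlin.inv_tendsto_atTop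
  · filter_upwards [Filter.eventually_ge_atTop 0] with y hy
    exact mul_nonneg (Real.exp_pos _).le (E1_nonneg (by positivity))
  · filter_upwards [Filter.eventually_ge_atTop 0] with y hy
    have hpos : 0 < b * y + c := by positivity
    calc Real.exp (a * y) * E1 (b * y + c)
        ≤ Real.exp (a * y) * (Real.exp (-(b * y + c)) / (b * y + c)) := by
          gcongr
          exact E1_le_exp_neg_div hpos
      _ = Real.exp (a * y + -(b * y + c)) * (b * y + c)⁻¹ := by
          rw [Real.exp_add, div_eq_mul_inv, mul_assoc]
      _ ≤ 1 * (b * y + c)⁻¹ := by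
          gcongr
          rw [Real.exp_le_one_iff]
          nlinarith [mul_le_mul_of_nonneg_right hab hy]
      _ = _ := one_mul _

lemma hasDerivAt_E1_mul_add {b c y : ℝ} (h : 0 < b * y + c) :
    HasDerivAt (fun y : ℝ => E1 (b * y + c)) (-(Real.exp (-(b * y + c)) / (b * y + c)) * b) y := by
  have hlin : HasDerivAt (fun y : ℝ => b * y + c) b y := by
    simpa using ((hasDerivAt_id y).const_mul b).add_const c
  exact (hasDerivAt_E1 h).comp y hlin

/-- Key integral in the logarithmic CoUD bound:
`∫_0^∞ e^{(β−λ)y} E1(βy + β/α) dy = ( e^{(λ−β)/α} E1(λ/α) − E1(β/α) )/(β−λ)`. -/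
theorem integral_exp_mul_E1 (lam beta alpha : ℝ) (hlam : 0 < lam) (hbeta : 0 < beta)
    (hne : beta ≠ lam) (halpha : 0 < alpha) :
    (∫ y in Set.Ioi (0:ℝ), Real.exp ((beta - lam) * y) * E1 (beta * y + beta / alpha))
      = (Real.exp ((lam - beta) / alpha) * E1 (lam / alpha) - E1 (beta / alpha))
          / (beta - lam) := by
  have hsub : beta - lam ≠ 0 := sub_ne_zero.2 hne
  let G : ℝ → ℝ := fun y => (Real.exp ((beta - lam) * y) * E1 (beta * y + beta / alpha)
    - Real.exp ((lam - beta) / alpha) * E1 (lam * y + lam / alpha)) / (beta - lam)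
  have hG : ∀ y ∈ Set.Ici (0 : ℝ), HasDerivAt G
      (Real.exp ((beta - lam) * y) * E1 (beta * y + beta / alpha)) y := by
    intro y hy
    have hy : 0 ≤ y := hy
    have hexp : HasDerivAt (fun y : ℝ => Real.exp ((beta - lam) * y))
        (Real.exp ((beta - lam) * y) * (beta - lam)) y := by
      simpa using ((hasDerivAt_id y).const_mul (beta - lam)).exp
    refine (((hexp.mul (hasDerivAt_E1_mul_add (by positivity))).sub
      ((hasDerivAt_E1_mul_add (by positivity)).const_mul _)).div_const _).congr_deriv ?_
    have hcancel : Real.exp ((beta - lam) * y) * Real.exp (-(beta * y + beta / alpha))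
        = Real.exp ((lam - beta) / alpha) * Real.exp (-(lam * y + lam / alpha)) := by
      rw [← Real.exp_add, ← Real.exp_add]
      ring_nf
    have hscale : ∀ b : ℝ, 0 < b → b / (b * y + b / alpha) = (y + 1 / alpha)⁻¹ := by
      intro b hb
      field_simp
    rw [div_eq_iff hsub]
    linear_combination (-(y + 1 / alpha)⁻¹) * hcancel
      - Real.exp ((beta - lam) * y) * Real.exp (-(beta * y + beta / alpha)) * hscale beta hbeta
      + Real.exp ((lam - beta) / alpha) * Real.exp (-(lam * y + lam / alpha)) * hscale lam hlam
  have hlim : Filter.Tendsto G Filter.atTop (nhds 0) := by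
    have hfirst := tendsto_exp_mul_E1_atTop (sub_le_self beta hlam.le) hbeta (div_pos hbeta halpha)
    have hsecond := tendsto_exp_mul_E1_atTop hlam.le hlam (div_pos hlam halpha)
    simpa [G] using (hfirst.sub (hsecond.const_mul (Real.exp ((lam - beta) / alpha)))).div_const
      (beta - lam)
  rw [integral_Ioi_of_hasDerivAt_of_nonneg' hG (fun y hy => ?_) hlim]
  · simp only [G, mul_zero, zero_add, Real.exp_zero, one_mul]
    ring
  · have hy : 0 < y := hy
    exact mul_nonneg (Real.exp_pos _).le (E1_nonneg (by positivity))
end
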